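/- arXiv:2401.01225 — 2 statements merged into one kernel-verified Lean document; each statement's English description precedes it below -/
import Mathlib

section
/- Let C be an evolutionary stable configuration on an m×n grid with m > 2 and n > 2. Then C_{m−1,2} = 0 and C_{m−1,n−1} = 0, i.e., in the penultimate row the second and the second-to-last lots are empty. -/
/-- Occupied lot `(i,j)` receives sunlight: the lot to its west, east or south
lies outside the `m × n` grid or is empty. -/
def Sun2 (m n : ℕ) (C : ℕ → ℕ → Bool) (i j : ℕ) : Prop :=
  (j = 1 ∨ C i (j - 1) = false) ∨ (j = n ∨ C i (j + 1) = false) ∨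
    (i = m ∨ C (i + 1) j = false)

/-- Every occupied lot of the `m × n` grid receives sunlight. -/
def Permissible2 (m n : ℕ) (C : ℕ → ℕ → Bool) : Prop :=
  ∀ i j, 1 ≤ i → i ≤ m → 1 ≤ j → j ≤ n → C i j = true → Sun2 m n C i j

/-- The configuration obtained by occupying lot `(i,j)`. -/
def occupy2 (C : ℕ → ℕ → Bool) (i j : ℕ) : ℕ → ℕ → Bool :=
  fun a b => if a = i ∧ b = j then true else C a b

/-- Maximal: permissible, and occupying any empty lot breaks permissibility. -/
def IsMaximal2 (m n : ℕ) (C : ℕ → ℕ → Bool) : Prop :=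
  Permissible2 m n C ∧ ∀ i j, 1 ≤ i → i ≤ m → 1 ≤ j → j ≤ n → C i j = false →
    ¬ Permissible2 m n (occupy2 C i j)

/-- Resistant to predators: a house built on any empty lot would get no sunlight. -/
def ResistPred2 (m n : ℕ) (C : ℕ → ℕ → Bool) : Prop :=
  ∀ i j, 1 ≤ i → i ≤ m → 1 ≤ j → j ≤ n → C i j = false →
    ¬ Sun2 m n (occupy2 C i j) i j

/-- Resistant to altruists: a house built on any empty lot would cut off sunlight
from some other occupied lot. -/
def ResistAlt2 (m n : ℕ) (C : ℕ → ℕ → Bool) : Prop :=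
  ∀ i j, 1 ≤ i → i ≤ m → 1 ≤ j → j ≤ n → C i j = false →
    ∃ a b, 1 ≤ a ∧ a ≤ m ∧ 1 ≤ b ∧ b ≤ n ∧ (a, b) ≠ (i, j) ∧ C a b = true ∧
      ¬ Sun2 m n (occupy2 C i j) a b

/-- Number of occupied lots in row `i`. -/
def rowOcc (n : ℕ) (C : ℕ → ℕ → Bool) (i : ℕ) : ℕ :=
  ((Finset.Icc 1 n).filter (fun j => C i j = true)).card

/-- Total number of occupied lots. -/
def totalOcc (m n : ℕ) (C : ℕ → ℕ → Bool) : ℕ :=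
  ∑ i ∈ Finset.Icc 1 m, rowOcc n C i

structure ESZ (m n : ℤ) (Z : ℤ → ℤ → Prop) : Prop where
  rng : ∀ i j, Z i j → 1 ≤ i ∧ i < m ∧ 1 < j ∧ j < n
  adjW : ∀ i j, Z i j → ¬ Z i (j - 1)
  adjE : ∀ i j, Z i j → ¬ Z i (j + 1)
  adjS : ∀ i j, Z i j → ¬ Z (i + 1) j
  sun : ∀ i j, 1 ≤ i → i < m → 1 < j → j < n → ¬ Z i j →
    Z i (j - 1) ∨ Z i (j + 1) ∨ Z (i + 1) j
  alt : ∀ i j, Z i j → (¬ Z (i + 1) (j - 1)) ∧ True ∧ 2 < j ∨ (¬ Z (i + 1) (j + 1)) ∧ j + 1 < n ∨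
    (1 < i ∧ ¬ Z (i - 1) (j - 1) ∧ ¬ Z (i - 1) j ∧ ¬ Z (i - 1) (j + 1))

theorem ESZ.mirror {m n : ℤ} {Z : ℤ → ℤ → Prop} (h : ESZ m n Z) :
    ESZ m n (fun i j => Z i (n + 1 - j)) := by
  have e1 : ∀ j : ℤ, n + 1 - (j - 1) = (n + 1 - j) + 1 := fun j => by ring
  have e2 : ∀ j : ℤ, n + 1 - (j + 1) = (n + 1 - j) - 1 := fun j => by ring
  refine ⟨?_, ?_, ?_, ?_, ?_, ?_⟩
  · intro i j hz
    have := h.rng _ _ hz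
    omega
  · intro i j hz
    rw [e1]; exact h.adjE _ _ hz
  · intro i j hz
    rw [e2]; exact h.adjW _ _ hz
  · intro i j hz
    exact h.adjS _ _ hz
  · intro i j h1 h2 h3 h4 hz
    rw [e1, e2]
    have := h.sun i (n + 1 - j) h1 h2 (by omega) (by omega) hz
    tauto
  · intro i j hz
    rw [e1, e2]
    rcases h.alt _ _ hz with a | a | a
    · right; left; exact ⟨a.1, by omega⟩
    · left; exact ⟨a.1, trivial, by omega⟩
    · right; right; tauto

theorem ESZ.key (m n : ℤ) (N : ℕ) : ∀ Z : ℤ → ℤ → Prop, ESZ m n Z → ∀ c : ℤ, ∀ k : ℕ,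
    (N : ℤ) + 2 < m →
    (∀ j : ℕ, j ≤ k → Z (N + 2) (c - 3 * j)) → (Z (N + 2) (c + 2) ∨ c + 2 = n) →
    ∀ j : ℕ, j ≤ k → Z (N + 1) (c + 1 - 3 * j) := by
  induction N with
  | zero =>
    intro Z h c k hm hz hd
    exfalso
    have z0 : Z 2 c := by simpa using hz 0 (by omega)
    have hd' : Z 2 (c + 2) ∨ c + 2 = n := by simpa using hd
    have r0 := h.rng _ _ z0
    have a0 := h.adjE _ _ z0
    have b1 : ¬ Z 1 c := fun hh => h.adjS _ _ hh (by simpa using z0)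
    have b2 : ¬ Z 1 (c + 2) := fun hh => by
      rcases hd' with q | q
      · exact h.adjS _ _ hh (by simpa using q)
      · have := h.rng _ _ hh; omega
    have cn : c + 1 < n := by
      rcases hd' with q | q
      · have := h.rng _ _ q; omega
      · omega
    have z1 : Z 1 (c + 1) := by
      by_contra hc
      rcases h.sun 1 (c + 1) (by omega) (by omega) (by omega) cn hc with q | q | q
      · exact b1 (by simpa using q)
      · exact b2 (by rwa [show c + 1 + 1 = c + 2 by ring] at q)
      · exact a0 (by simpa using q)
    rcases h.alt _ _ z1 with q | q | q
    · exact q.1 (by simpa using z0)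
    · rcases hd' with p | p
      · exact q.1 (by rwa [show (1 : ℤ) + 1 = 2 by ring, show c + 1 + 1 = c + 2 by ring])
      · omega
    · omega
  | succ N ih =>
    intro Z h c k hm hz hd
    push_cast at hm hz hd ⊢
    rw [show (N : ℤ) + 1 + 2 = N + 3 by ring] at hm hd
    simp only [show (N : ℤ) + 1 + 2 = N + 3 by ring] at hz
    rw [show (N : ℤ) + 1 + 1 = N + 2 by ring]
    have up : ∀ x, Z (N + 3) x → ¬ Z (N + 2) x := fun x hx hh => h.adjS _ _ hh
      (by rwa [show (N : ℤ) + 2 + 1 = N + 3 by ring])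
    have z0 : Z (N + 3) c := by simpa using hz 0 (by omega)
    have r0 := h.rng _ _ z0
    have a0 := h.adjE _ _ z0
    have b1 : ¬ Z (N + 2) c := up _ z0
    have b2 : ¬ Z (N + 2) (c + 2) := fun hh => by
      rcases hd with q | q
      · exact up _ q hh
      · have := h.rng _ _ hh; omega
    have cn : c + 1 < n := by
      rcases hd with q | q
      · have := h.rng _ _ q; omega
      · omega
    have z1 : Z (N + 2) (c + 1) := by
      by_contra hc
      rcases h.sun (N + 2) (c + 1) (by omega) (by omega) (by omega) cn hc with q | q | q
      · exact b1 (by simpa using q)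
      · exact b2 (by rwa [show c + 1 + 1 = c + 2 by ring] at q)
      · exact a0 (by rwa [show (N : ℤ) + 2 + 1 = N + 3 by ring] at q)
    have nc : ¬ Z (N + 1) c := by
      rcases h.alt _ _ z1 with q | q | q
      · exact absurd (by rwa [show (N : ℤ) + 2 + 1 = N + 3 by ring, show c + 1 - 1 = c by ring]) q.1
      · rcases hd with p | p
        · exact absurd (by rwa [show (N : ℤ) + 2 + 1 = N + 3 by ring, show c + 1 + 1 = c + 2 by ring]) q.1
        · omega
      · have := q.2.1
        rwa [show (N : ℤ) + 2 - 1 = N + 1 by ring, show c + 1 - 1 = c by ring] at this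
    have main : ∀ j : ℕ, j ≤ k → ∀ l : ℕ, l ≤ j → Z (N + 2) (c + 1 - 3 * l) := by
      intro j
      induction j with
      | zero =>
        intro _ l hl
        obtain rfl : l = 0 := by omega
        simpa using z1
      | succ j ihj =>
        intro hj l hl
        have prev := ihj (by omega)
        by_cases hlj : l ≤ j
        · exact prev l hlj
        obtain rfl : l = j + 1 := by omega
        push_cast
        have y1 := hz j (by omega)
        have y2 := hz (j + 1) (by omega)
        push_cast at y2
        have r2 := h.rng _ _ y2
        by_cases hd0 : Z (N + 2) (c - 1 - 3 * j)
        · exfalso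
          apply nc
          have := ih _ h.mirror (n + 1 - (c + 1 - 3 * j)) j (by omega) ?_ ?_ j le_rfl
          · simpa only [show n + 1 - (n + 1 - (c + 1 - 3 * (j : ℤ)) + 1 - 3 * j) = c by ring] using this
          · intro l hl
            have := prev (j - l) (by omega)
            rw [Nat.cast_sub hl] at this
            simpa only [show n + 1 - (n + 1 - (c + 1 - 3 * (j : ℤ)) - 3 * l) = c + 1 - 3 * (j - l) by ring] using this
          · left
            simpa only [show n + 1 - (n + 1 - (c + 1 - 3 * (j : ℤ)) + 2) = c - 1 - 3 * j by ring] using hd0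
        · rcases h.sun (N + 2) (c - 1 - 3 * j) (by omega) (by omega) (by omega) (by omega) hd0 with q | q | q
          · rwa [show c - 1 - 3 * (j : ℤ) - 1 = c + 1 - 3 * (j + 1) by ring] at q
          · exact absurd (by rwa [show c - 1 - 3 * (j : ℤ) + 1 = c - 3 * j by ring] at q) (up _ y1)
          · have := h.adjW _ _ y1
            rw [show (N : ℤ) + 2 + 1 = N + 3 by ring] at q
            exact absurd (by rwa [show c - 1 - 3 * (j : ℤ) = c - 3 * j - 1 by ring] at q) this
    exact fun j hj => main j hj j le_rfl

theorem ESZ.left {m n : ℤ} {Z : ℤ → ℤ → Prop} (h : ESZ m n Z) (hm : 2 < m) (hn : 2 < n) :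
    Z (m - 1) 2 := by
  by_contra hc
  have bot : ∀ x, ¬ Z m x := fun x hx => by have := h.rng _ _ hx; omega
  have z3 : Z (m - 1) 3 := by
    rcases h.sun (m - 1) 2 (by omega) (by omega) (by omega) (by omega) hc with q | q | q
    · have := h.rng _ _ q; omega
    · simpa using q
    · exact absurd (by simpa using q) (bot 2)
  have n3 := h.rng _ _ z3
  have u3 : ¬ Z (m - 2) 3 := fun hh => h.adjS _ _ hh (by rwa [show m - 2 + 1 = m - 1 by ring])
  have z2 : Z (m - 2) 2 := by
    by_contra hc2
    rcases h.sun (m - 2) 2 (by omega) (by omega) (by omega) (by omega) hc2 with q | q | q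
    · have := h.rng _ _ q; omega
    · exact u3 (by simpa using q)
    · exact hc (by rwa [show m - 2 + 1 = m - 1 by ring] at q)
  obtain ⟨hm3, w3⟩ : 1 < m - 2 ∧ ¬ Z (m - 3) 3 := by
    rcases h.alt _ _ z2 with q | q | q
    · omega
    · exact absurd (by rw [show m - 2 + 1 = m - 1 by ring]; simpa using z3) q.1
    · refine ⟨q.1, ?_⟩
      have := q.2.2.2
      rw [show m - 2 - 1 = m - 3 by ring] at this
      simpa using this
  obtain ⟨N, hN⟩ : ∃ N : ℕ, m = N + 4 := ⟨(m - 4).toNat, by omega⟩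
  have claim : ∀ t : ℕ, ∀ s : ℕ, s ≤ t → Z (m - 1) (3 * s + 3) ∧ Z (m - 2) (3 * s + 2) := by
    intro t
    induction t with
    | zero =>
      intro s hs
      obtain rfl : s = 0 := by omega
      simpa using And.intro z3 z2
    | succ t ih =>
      intro s hs
      by_cases hst : s ≤ t
      · exact ih s hst
      obtain rfl : s = t + 1 := by omega
      obtain ⟨p1, p2⟩ := ih t le_rfl
      have r1 := h.rng _ _ p1
      have nd : ¬ (Z (m - 2) (3 * t + 2 + 2) ∨ (3 * t + 2 + 2 : ℤ) = n) := by
        intro hd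
        apply w3
        have := ESZ.key m n N Z h (3 * t + 2) t (by omega) ?_ ?_ t le_rfl
        · rw [show (N : ℤ) + 1 = m - 3 by omega] at this
          simpa only [show (3 * t + 2 + 1 - 3 * t : ℤ) = 3 by ring] using this
        · intro j hj
          have := (ih (t - j) (by omega)).2
          rw [Nat.cast_sub hj] at this
          rw [show (N : ℤ) + 2 = m - 2 by omega]
          rwa [show (3 * t + 2 - 3 * j : ℤ) = 3 * (t - j) + 2 by ring]
        · rwa [show (N : ℤ) + 2 = m - 2 by omega]
      push Not at nd
      have q2 : Z (m - 2) (3 * t + 5) := by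
        rcases h.sun (m - 2) (3 * t + 2 + 2) (by omega) (by omega) (by omega) (by omega) nd.1 with q | q | q
        · exact absurd (by rwa [show (3 * t + 2 + 2 - 1 : ℤ) = 3 * t + 2 + 1 by ring] at q) (h.adjE _ _ p2)
        · rwa [show (3 * t + 2 + 2 + 1 : ℤ) = 3 * t + 5 by ring] at q
        · exact absurd (by rwa [show m - 2 + 1 = m - 1 by ring, show (3 * t + 2 + 2 : ℤ) = 3 * t + 3 + 1 by ring] at q) (h.adjE _ _ p1)
      have r2 := h.rng _ _ q2
      have nq := h.adjS _ _ q2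
      rw [show m - 2 + 1 = m - 1 by ring] at nq
      have q1 : Z (m - 1) (3 * t + 6) := by
        rcases h.sun (m - 1) (3 * t + 5) (by omega) (by omega) (by omega) (by omega) nq with q | q | q
        · exact absurd (by rwa [show (3 * t + 5 - 1 : ℤ) = 3 * t + 3 + 1 by ring] at q) (h.adjE _ _ p1)
        · rwa [show (3 * t + 5 + 1 : ℤ) = 3 * t + 6 by ring] at q
        · exact absurd (by simpa using q) (bot (3 * t + 5))
      push_cast
      rw [show (3 * (t + 1) + 3 : ℤ) = 3 * t + 6 by ring, show (3 * (t + 1) + 2 : ℤ) = 3 * t + 5 by ring]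
      exact ⟨q1, q2⟩
  have := h.rng _ _ (claim n.toNat n.toNat le_rfl).1
  omega

theorem ESZ.ofConfig (m n : ℕ) (C : ℕ → ℕ → Bool)
    (hmax : IsMaximal2 m n C) (hp : ResistPred2 m n C) (ha : ResistAlt2 m n C) :
    ESZ m n (fun x y => ∃ i j : ℕ, x = i ∧ y = j ∧ 1 ≤ i ∧ i ≤ m ∧ 1 ≤ j ∧ j ≤ n ∧
      C i j = false) := by
  have P : ∀ i j : ℕ, 1 ≤ i → i ≤ m → 1 ≤ j → j ≤ n → C i j = false →
      i < m ∧ 1 < j ∧ j < n ∧ C i (j - 1) = true ∧ C i (j + 1) = true ∧ C (i + 1) j = true := by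
    intro i j h1 h2 h3 h4 h5
    have := hp i j h1 h2 h3 h4 h5
    simp only [Sun2, occupy2, not_or] at this
    obtain ⟨⟨a1, a2⟩, ⟨b1, b2⟩, c1, c2⟩ := this
    rw [if_neg (by omega)] at a2 b2 c2
    simp only [Bool.not_eq_false] at a2 b2 c2
    exact ⟨by omega, by omega, by omega, a2, b2, c2⟩
  refine ⟨?_, ?_, ?_, ?_, ?_, ?_⟩
  · rintro _ _ ⟨i, j, rfl, rfl, h1, h2, h3, h4, h5⟩
    have := P i j h1 h2 h3 h4 h5
    omega
  · rintro _ _ ⟨i, j, rfl, rfl, h1, h2, h3, h4, h5⟩ ⟨i', j', e1, e2, -, -, -, -, h⟩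
    have := P i j h1 h2 h3 h4 h5
    obtain rfl : i' = i := by omega
    obtain rfl : j' = j - 1 := by omega
    simp [h] at this
  · rintro _ _ ⟨i, j, rfl, rfl, h1, h2, h3, h4, h5⟩ ⟨i', j', e1, e2, -, -, -, -, h⟩
    have := P i j h1 h2 h3 h4 h5
    obtain rfl : i' = i := by omega
    obtain rfl : j' = j + 1 := by omega
    simp [h] at this
  · rintro _ _ ⟨i, j, rfl, rfl, h1, h2, h3, h4, h5⟩ ⟨i', j', e1, e2, -, -, -, -, h⟩
    have := P i j h1 h2 h3 h4 h5
    obtain rfl : i' = i + 1 := by omega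
    obtain rfl : j' = j := by omega
    simp [h] at this
  · intro x y h1 h2 h3 h4 hz
    obtain ⟨i, rfl⟩ := Int.eq_ofNat_of_zero_le (show 0 ≤ x by omega)
    obtain ⟨j, rfl⟩ := Int.eq_ofNat_of_zero_le (show 0 ≤ y by omega)
    have ho : C i j = true := by
      by_contra hc
      exact hz ⟨i, j, rfl, rfl, by omega, by omega, by omega, by omega, by simpa using hc⟩
    rcases hmax.1 i j (by omega) (by omega) (by omega) (by omega) ho with (q | q) | (q | q) | (q | q)
    · omega
    · left; exact ⟨i, j - 1, rfl, by omega, by omega, by omega, by omega, by omega, q⟩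
    · omega
    · right; left; exact ⟨i, j + 1, rfl, by omega, by omega, by omega, by omega, by omega, q⟩
    · omega
    · right; right; exact ⟨i + 1, j, by omega, rfl, by omega, by omega, by omega, by omega, q⟩
  · rintro _ _ ⟨i, j, rfl, rfl, h1, h2, h3, h4, h5⟩
    have hP := P i j h1 h2 h3 h4 h5
    obtain ⟨a, b, g1, g2, g3, g4, hne, hab, hs⟩ := ha i j h1 h2 h3 h4 h5
    have hs0 := hmax.1 a b g1 g2 g3 g4 hab
    simp only [Sun2, occupy2, not_or] at hs
    obtain ⟨⟨a1, a2⟩, ⟨b1, b2⟩, c1, c2⟩ := hs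
    have ncell : ∀ i' j' : ℕ, ¬ (i' = i ∧ j' = j) → C i' j' = true → ∀ x y : ℤ, x = i' → y = j' →
        ¬ ∃ i j : ℕ, x = i ∧ y = j ∧ 1 ≤ i ∧ i ≤ m ∧ 1 ≤ j ∧ j ≤ n ∧ C i j = false := by
      rintro i' j' - hc x y rfl rfl ⟨i2, j2, e1, e2, -, -, -, -, hf⟩
      obtain rfl : i' = i2 := by omega
      obtain rfl : j' = j2 := by omega
      simp [hc] at hf
    have fix : ∀ i' j' : ℕ, ¬ (i' = i ∧ j' = j) →
        ¬ (if i' = i ∧ j' = j then true else C i' j') = false → C i' j' = true := by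
      intro i' j' hh h'
      rw [if_neg hh] at h'
      simpa using h'
    by_cases k1 : a = i ∧ b - 1 = j
    · -- east neighbour
      right; left
      have t3 := fix _ _ (by omega) c2
      exact ⟨ncell _ _ (by omega) t3 _ _ (by omega) (by omega), by omega⟩
    by_cases k2 : a = i ∧ b + 1 = j
    · left
      have t3 := fix _ _ (by omega) c2
      exact ⟨ncell _ _ (by omega) t3 _ _ (by omega) (by omega), trivial, by omega⟩
    have t1 := fix _ _ k1 a2
    have t2 := fix _ _ k2 b2
    by_cases k3 : a + 1 = i ∧ b = j
    · right; right
      exact ⟨by omega, ncell _ _ k1 t1 _ _ (by omega) (by omega),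
        ncell a b (by omega) hab _ _ (by omega) (by omega),
        ncell _ _ k2 t2 _ _ (by omega) (by omega)⟩
    have t3 := fix _ _ k3 c2
    simp [Sun2, t1, t2, t3, a1, b1, c1] at hs0

/-- in an `m × n` ES configuration with `m, n > 2`, the second and the
second-to-last lots of the penultimate row are empty. -/
theorem stmt15 (m n : ℕ) (hm : 2 < m) (hn : 2 < n) (C : ℕ → ℕ → Bool)
    (hmax : IsMaximal2 m n C) (hp : ResistPred2 m n C) (ha : ResistAlt2 m n C) :
    C (m - 1) 2 = false ∧ C (m - 1) (n - 1) = false := by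
  have h := ESZ.ofConfig m n C hmax hp ha
  constructor
  · obtain ⟨i, j, e1, e2, -, -, -, -, hf⟩ := h.left (by omega) (by omega)
    obtain rfl : i = m - 1 := by omega
    obtain rfl : j = 2 := by omega
    exact hf
  · obtain ⟨i, j, e1, e2, -, -, -, -, hf⟩ := h.mirror.left (by omega) (by omega)
    obtain rfl : i = m - 1 := by omega
    obtain rfl : j = n - 1 := by omega
    exact hf
end

section
/- Let C be an evolutionary stable configuration on an m×n grid with m > 2. Then no two empty lots in the penultimate row (row m−1) are separated by a single occupied lot; that is, there is no column index j with 1 < j < n such that C_{m−1,j−1} = 0, C_{m−1,j} = 1, and C_{m−1,j+1} = 0. -/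
/-- Indicator of an empty lot. -/
def emp (C : ℕ → ℕ → Bool) (i c : ℕ) : ℤ := if C i c = true then 0 else 1

/-- Prefix sums over columns `1..k`. -/
def pre (x : ℕ → ℤ) (k : ℕ) : ℤ := ∑ c ∈ Finset.range k, x (c + 1)

theorem pre_succ (x : ℕ → ℤ) (k : ℕ) : pre x (k + 1) = pre x k + x (k + 1) := by
  simp [pre, Finset.sum_range_succ]

theorem pre_zero (x : ℕ → ℤ) : pre x 0 = 0 := by simp [pre]

theorem up_aux (x y : ℕ → ℤ) (n : ℕ) (hx : ∀ c, x c = 0 ∨ x c = 1)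
    (hy : ∀ c, y c = 0 ∨ y c = 1) (x1 : x 1 = 0) (y1 : y 1 = 0)
    (hv : ∀ c, 1 ≤ c → c ≤ n → x c + y c ≤ 1)
    (hh : ∀ c, 1 ≤ c → c + 1 ≤ n → x c + x (c + 1) ≤ 1)
    (hw : ∀ c, 1 ≤ c → c + 2 ≤ n → 1 ≤ y c + y (c + 1) + y (c + 2) + x (c + 1))
    (k : ℕ) (hk : k + 2 ≤ n) :
    1 ≤ pre y (k + 2) + x 2 - pre x (k + 2) ∨
    (0 ≤ pre y (k + 2) + x 2 - pre x (k + 2) ∧ x (k + 2) = 1) ∨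
    (0 ≤ pre y (k + 2) + x 2 - pre x (k + 2) ∧ x (k + 2) = 0 ∧ y (k + 2) = 0 ∧
      y (k + 1) = 0) := by
  induction k with
  | zero =>
    have h1 := pre_succ x 0
    have h2 := pre_succ x 1
    have h3 := pre_succ y 0
    have h4 := pre_succ y 1
    have h5 := pre_zero x
    have h6 := pre_zero y
    have := hx 2
    have := hy 2
    have := hv 2 (by omega) (by omega)
    simp only [Nat.zero_add, Nat.reduceAdd] at *
    omega
  | succ k ih =>
    have ih := ih (by omega)
    have e1 := pre_succ x (k + 2)
    have e2 := pre_succ y (k + 2)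
    have h1 := hw (k + 1) (by omega) (by omega)
    have h2 := hh (k + 2) (by omega) (by omega)
    have h3 := hv (k + 2) (by omega) (by omega)
    have h4 := hv (k + 3) (by omega) (by omega)
    have h5 := hx (k + 3)
    have h6 := hy (k + 3)
    have h7 := hy (k + 2)
    have e3 : k + 1 + 2 = k + 3 := by omega
    have e4 : k + 2 + 1 = k + 3 := by omega
    have e5 : k + 1 + 1 = k + 2 := by omega
    rw [e3, e5] at *
    rw [e4] at *
    omega

/-- The row above has at least `e + 1 - a - b` empty lots. -/
theorem up_main (x y : ℕ → ℤ) (N : ℕ) (hx : ∀ c, x c = 0 ∨ x c = 1)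
    (hy : ∀ c, y c = 0 ∨ y c = 1) (x1 : x 1 = 0) (y1 : y 1 = 0)
    (xn : x (N + 3) = 0) (yn : y (N + 3) = 0)
    (hv : ∀ c, 1 ≤ c → c ≤ N + 3 → x c + y c ≤ 1)
    (hh : ∀ c, 1 ≤ c → c + 1 ≤ N + 3 → x c + x (c + 1) ≤ 1)
    (hw : ∀ c, 1 ≤ c → c + 2 ≤ N + 3 → 1 ≤ y c + y (c + 1) + y (c + 2) + x (c + 1)) :
    pre x (N + 3) + 1 ≤ pre y (N + 3) + x 2 + x (N + 2) := by
  have h := up_aux x y (N + 3) hx hy x1 y1 hv hh hw N (by omega)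
  have e1 := pre_succ x (N + 2)
  have e2 := pre_succ y (N + 2)
  have h1 := hw (N + 1) (by omega) (by omega)
  have e4 : N + 2 + 1 = N + 3 := by omega
  have e3 : N + 1 + 2 = N + 3 := by omega
  have e5 : N + 1 + 1 = N + 2 := by omega
  rw [e4] at e1 e2
  rw [e3, e5] at h1
  have := hx (N + 2)
  omega

theorem win_sum (x : ℕ → ℤ) (N : ℕ) (x1 : x 1 = 0) :
    ∑ c ∈ Finset.range (N + 1), (x (c + 1) + x (c + 2) + x (c + 3)) =
      3 * pre x (N + 3) - x 2 - x (N + 2) - 2 * x (N + 3) := by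
  induction N with
  | zero =>
    have h1 := pre_succ x 0
    have h2 := pre_succ x 1
    have h3 := pre_succ x 2
    have h4 := pre_zero x
    simp only [Nat.zero_add, Nat.reduceAdd, Finset.sum_range_one] at *
    omega
  | succ N ih =>
    rw [Finset.sum_range_succ, ih]
    have h := pre_succ x (N + 3)
    have e1 : N + 1 + 3 = N + 3 + 1 := by omega
    have e2 : N + 1 + 2 = N + 3 := by omega
    have e3 : N + 1 + 1 = N + 2 := by omega
    rw [e1, e2, e3, h]
    ring

theorem top_aux (m n : ℕ) (hm : 2 < m) (C : ℕ → ℕ → Bool)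
    (hmax : IsMaximal2 m n C) (ha : ResistAlt2 m n C) (c : ℕ) (hc : 1 < c) (hcn : c < n)
    (h : C 1 c = false) (hl : c = 2 ∨ C 2 (c - 1) = false) (hr : C 2 (c + 1) = false) :
    False := by
  obtain ⟨a, b, h1, h2, h3, h4, h5, h6, h7⟩ := ha 1 c le_rfl (by omega) (by omega) (by omega) h
  have hs := hmax.1 a b h1 h2 h3 h4 h6
  unfold Sun2 occupy2 at h7
  unfold Sun2 at hs
  push Not at h7
  obtain ⟨⟨g1, g2⟩, ⟨g3, g4⟩, g5, g6⟩ := h7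
  have key : a = 1 ∧ (b - 1 = c ∨ b + 1 = c) := by
    by_contra hcon
    have n1 : ¬ (a = 1 ∧ b - 1 = c) := by tauto
    have n2 : ¬ (a = 1 ∧ b + 1 = c) := by tauto
    have n3 : ¬ (a + 1 = 1 ∧ b = c) := by omega
    rw [if_neg n1] at g2
    rw [if_neg n2] at g4
    rw [if_neg n3] at g6
    tauto
  obtain ⟨rfl, hb⟩ := key
  rw [if_neg (by omega)] at g6
  rcases hb with hb | hb
  · have : b = c + 1 := by omega
    subst this
    exact g6 hr
  · have : b = c - 1 := by omega
    subst this
    rcases hl with hl | hl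
    · omega
    · exact g6 hl

theorem emp_or (C : ℕ → ℕ → Bool) (i c : ℕ) : emp C i c = 0 ∨ emp C i c = 1 := by
  unfold emp; split <;> simp

theorem emp_one (C : ℕ → ℕ → Bool) (i c : ℕ) : emp C i c = 1 ↔ C i c = false := by
  unfold emp; cases C i c <;> simp

theorem emp_zero (C : ℕ → ℕ → Bool) (i c : ℕ) : emp C i c = 0 ↔ C i c = true := by
  unfold emp; cases C i c <;> simp

theorem pred_aux (m n : ℕ) (C : ℕ → ℕ → Bool) (hp : ResistPred2 m n C) (i j : ℕ)
    (h1 : 1 ≤ i) (h2 : i ≤ m) (h3 : 1 ≤ j) (h4 : j ≤ n) (h : C i j = false) :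
    i < m ∧ 1 < j ∧ j < n ∧ C i (j + 1) = true ∧ C (i + 1) j = true := by
  have h7 := hp i j h1 h2 h3 h4 h
  unfold Sun2 occupy2 at h7
  push Not at h7
  obtain ⟨⟨g1, g2⟩, ⟨g3, g4⟩, g5, g6⟩ := h7
  rw [if_neg (by omega)] at g4 g6
  refine ⟨by omega, by omega, by omega, ?_, ?_⟩
  · simpa using g4
  · simpa using g6

theorem stmt16 (m n : ℕ) (hm : 2 < m) (C : ℕ → ℕ → Bool)
    (hmax : IsMaximal2 m n C) (hp : ResistPred2 m n C) (ha : ResistAlt2 m n C) :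
    ¬ ∃ j, 1 < j ∧ j < n ∧ C (m - 1) (j - 1) = false ∧ C (m - 1) j = true ∧
      C (m - 1) (j + 1) = false := by
  rintro ⟨j, hj1, hjn, hjl, -, hjr⟩
  obtain ⟨N, rfl⟩ : ∃ N, n = N + 3 := ⟨n - 3, by omega⟩
  have hP := pred_aux m (N + 3) C hp
  have E := emp_or C
  have c1 : ∀ i, 1 ≤ i → i ≤ m → emp C i 1 = 0 := by
    intro i h1 h2
    rcases E i 1 with h | h
    · exact h
    · have := hP i 1 h1 h2 (by omega) (by omega) ((emp_one _ _ _).1 h)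
      omega
  have cn : ∀ i, 1 ≤ i → i ≤ m → emp C i (N + 3) = 0 := by
    intro i h1 h2
    rcases E i (N + 3) with h | h
    · exact h
    · have := hP i (N + 3) h1 h2 (by omega) (by omega) ((emp_one _ _ _).1 h)
      omega
  have bot : ∀ c, 1 ≤ c → c ≤ N + 3 → emp C m c = 0 := by
    intro c h1 h2
    rcases E m c with h | h
    · exact h
    · have := hP m c (by omega) le_rfl h1 h2 ((emp_one _ _ _).1 h)
      omega
  have hv : ∀ i c, 1 ≤ i → i + 1 ≤ m → 1 ≤ c → c ≤ N + 3 →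
      emp C (i + 1) c + emp C i c ≤ 1 := by
    intro i c h1 h2 h3 h4
    rcases E i c with h | h
    · have := E (i + 1) c
      omega
    · have := hP i c h1 (by omega) h3 h4 ((emp_one _ _ _).1 h)
      have := (emp_zero _ _ _).2 this.2.2.2.2
      omega
  have hh : ∀ i c, 1 ≤ i → i ≤ m → 1 ≤ c → c + 1 ≤ N + 3 →
      emp C i c + emp C i (c + 1) ≤ 1 := by
    intro i c h1 h2 h3 h4
    rcases E i c with h | h
    · have := E i (c + 1)
      omega
    · have := hP i c h1 (by omega) h3 (by omega) ((emp_one _ _ _).1 h)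
      have := (emp_zero _ _ _).2 this.2.2.2.1
      omega
  have hw : ∀ i c, 1 ≤ i → i + 1 ≤ m → 1 ≤ c → c + 2 ≤ N + 3 →
      1 ≤ emp C i c + emp C i (c + 1) + emp C i (c + 2) + emp C (i + 1) (c + 1) := by
    intro i c h1 h2 h3 h4
    have := E i c
    have := E i (c + 1)
    have := E i (c + 2)
    have := E (i + 1) (c + 1)
    rcases E i (c + 1) with h | h
    · have hs := hmax.1 i (c + 1) h1 (by omega) (by omega) (by omega) ((emp_zero _ _ _).1 h)
      unfold Sun2 at hs
      simp only [← emp_one] at hs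
      have e : c + 1 - 1 = c := by omega
      have e' : c + 1 + 1 = c + 2 := by omega
      rw [e, e'] at hs
      omega
    · omega
  -- base row
  have base : 2 * (N + 3 : ℤ) ≤ 6 * pre (emp C (m - 1)) (N + 3) + 4
      - 3 * (emp C (m - 1) 2 + emp C (m - 1) (N + 2)) := by
    have hs := win_sum (emp C (m - 1)) N (c1 _ (by omega) (by omega))
    have hlt : ∑ c ∈ Finset.range (N + 1), (1 : ℤ) < ∑ c ∈ Finset.range (N + 1),
        (emp C (m - 1) (c + 1) + emp C (m - 1) (c + 2) + emp C (m - 1) (c + 3)) := by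
      apply Finset.sum_lt_sum
      · intro c hc
        rw [Finset.mem_range] at hc
        have := hw (m - 1) (c + 1) (by omega) (by omega) (by omega) (by omega)
        have e : m - 1 + 1 = m := by omega
        have e' : c + 1 + 1 = c + 2 := by omega
        have e'' : c + 1 + 2 = c + 3 := by omega
        rw [e, e', e''] at this
        have := bot (c + 2) (by omega) (by omega)
        omega
      · refine ⟨j - 2, by rw [Finset.mem_range]; omega, ?_⟩
        have e : j - 2 + 1 = j - 1 := by omega
        have e' : j - 2 + 3 = j + 1 := by omega
        rw [e, e', (emp_one _ _ _).2 hjl, (emp_one _ _ _).2 hjr]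
        have := E (m - 1) (j - 2 + 2)
        omega
    rw [hs] at hlt
    simp only [Finset.sum_const, Finset.card_range, nsmul_eq_mul, mul_one] at hlt
    push_cast at hlt
    have := cn (m - 1) (by omega) (by omega)
    have := E (m - 1) 2
    have := E (m - 1) (N + 2)
    omega
  have ind : ∀ k, k + 2 ≤ m - 1 → 2 * (N + 3 : ℤ) ≤ 6 * pre (emp C (m - 1 - k)) (N + 3) + 4
      - 3 * (emp C (m - 1 - k) 2 + emp C (m - 1 - k) (N + 2)) := by
    intro k
    induction k with
    | zero => intro _; simpa using base
    | succ k ih =>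
      intro hk
      have ih := ih (by omega)
      obtain ⟨i, hi⟩ : ∃ i, i = m - 1 - (k + 1) := ⟨_, rfl⟩
      have hi' : m - 1 - k = i + 1 := by omega
      rw [hi'] at ih
      rw [← hi]
      have := up_main (emp C (i + 1)) (emp C i) N (E _) (E _) (c1 _ (by omega) (by omega))
        (c1 _ (by omega) (by omega)) (cn _ (by omega) (by omega)) (cn _ (by omega) (by omega))
        (fun c h h' => hv i c (by omega) (by omega) h h')
        (fun c h h' => hh (i + 1) c (by omega) (by omega) h h')
        (fun c h h' => hw i c (by omega) (by omega) h h')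
      have := hv i 2 (by omega) (by omega) (by omega) (by omega)
      have := hv i (N + 2) (by omega) (by omega) (by omega) (by omega)
      omega
  have fin2 := ind (m - 3) (by omega)
  have e2 : m - 1 - (m - 3) = 2 := by omega
  rw [e2] at fin2
  have hs := win_sum (emp C 2) N (c1 _ (by omega) (by omega))
  have hle : ∀ c ∈ Finset.range (N + 1),
      emp C 2 (c + 1) + emp C 2 (c + 2) + emp C 2 (c + 3) ≤ 1 := by
    intro c hc
    rw [Finset.mem_range] at hc
    by_contra hcon
    have a1 := hh 2 (c + 1) (by omega) (by omega) (by omega) (by omega)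
    have a2 := hh 2 (c + 2) (by omega) (by omega) (by omega) (by omega)
    have b1 := E 2 (c + 1)
    have b2 := E 2 (c + 2)
    have b3 := E 2 (c + 3)
    rw [show c + 1 + 1 = c + 2 by omega] at a1
    rw [show c + 2 + 1 = c + 3 by omega] at a2
    have f1 : emp C 2 (c + 1) = 1 := by omega
    have f3 : emp C 2 (c + 3) = 1 := by omega
    have v1 := hv 1 (c + 1) (by omega) (by omega) (by omega) (by omega)
    have v3 := hv 1 (c + 3) (by omega) (by omega) (by omega) (by omega)
    have w := hw 1 (c + 1) (by omega) (by omega) (by omega) (by omega)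
    rw [show c + 1 + 1 = c + 2 by omega, show c + 1 + 2 = c + 3 by omega] at w
    norm_num at v1 v3 w
    have d1 := E 1 (c + 1)
    have d2 := E 1 (c + 2)
    have d3 := E 1 (c + 3)
    have f2 : emp C 1 (c + 2) = 1 := by omega
    exact top_aux m (N + 3) hm C hmax ha (c + 2) (by omega) (by omega) ((emp_one _ _ _).1 f2)
      (Or.inr ((emp_one _ _ _).1 f1)) ((emp_one _ _ _).1 f3)
  have t1 := cn 2 (by omega) (by omega)
  have t2 := E 2 2
  have t3 := E 2 (N + 2)
  have t4 := E 2 3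
  have hsum := Finset.sum_le_sum hle
  have g1 : emp C 2 2 = 0 := by
    rw [hs] at hsum
    simp only [Finset.sum_const, Finset.card_range, nsmul_eq_mul, mul_one] at hsum
    push_cast at hsum
    omega
  have g3 : emp C 2 3 = 1 := by
    by_contra hcon
    have hlt := Finset.sum_lt_sum hle ⟨0, by simp, by
      have := c1 2 (by omega) (by omega)
      simp only [Nat.zero_add]
      omega⟩
    rw [hs] at hlt
    simp only [Finset.sum_const, Finset.card_range, nsmul_eq_mul, mul_one] at hlt
    push_cast at hlt
    omega
  have hN : 1 ≤ N := by
    by_contra h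
    have : N = 0 := by omega
    subst this
    simp only [Nat.zero_add] at t1
    omega
  have w := hw 1 1 (by omega) (by omega) (by omega) (by omega)
  have v3 := hv 1 3 (by omega) (by omega) (by omega) (by omega)
  have d1 := c1 1 (by omega) (by omega)
  have d2 := E 1 2
  have d3 := E 1 3
  norm_num at w v3
  have f2 : emp C 1 2 = 1 := by omega
  exact top_aux m (N + 3) hm C hmax ha 2 (by omega) (by omega) ((emp_one _ _ _).1 f2)
    (Or.inl rfl) ((emp_one _ _ _).1 g3)
end
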